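/- In R = MvPolynomial (Fin 9) ℤ, the second elementary symmetric function of the multiset W((3,3), 9) of weights of semistandard Young tableaux of shape (3,3) with entries in {0,…,8} is congruent to 3465·e₂ modulo the ideal generated by e₁; equivalently, c₂(γ₉^{(3,3)}) = 3465·c₂(γ₉), the Table 2 entry for the weight 3α₂ of SL₉/μ₃. -/

import Mathlib

open MvPolynomial

open scoped Classical in
/-- The multiset `W(lam, n)` of weights of semistandard Young tableaux of shape
`lam` (a list of row lengths) with entries in `{0, …, n-1}`: a tableau assigns
to each cell `(i, j)` of the Young diagram of `lam` an entry in `Fin n`, weakly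
increasing along rows and strictly increasing down columns; its weight is the
sum `∑_{(i,j) ∈ lam} X_{T(i,j)}`. -/
noncomputable def ssytWeights (lam : List ℕ) (n : ℕ) :
    Multiset (MvPolynomial (Fin n) ℤ) :=
  ((Finset.univ : Finset ((i : Fin lam.length) → Fin (lam.get i) → Fin n)).filter
      (fun T =>
        (∀ (i : Fin lam.length) (j j' : Fin (lam.get i)), (j : ℕ) ≤ (j' : ℕ) → T i j ≤ T i j') ∧
        (∀ (i i' : Fin lam.length), (i : ℕ) < (i' : ℕ) →
          ∀ (j : Fin (lam.get i')) (hj : (j : ℕ) < lam.get i), T i ⟨j, hj⟩ < T i' j))).val.map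
    (fun T => ∑ i, ∑ j, MvPolynomial.X (T i j))

/-- Twice the second elementary symmetric function is the square of the sum minus the sum of the
squares. -/
theorem Multiset.two_mul_esymm_two {R : Type*} [CommRing R] (s : Multiset R) :
    2 * s.esymm 2 = s.sum ^ 2 - (s.map (· ^ 2)).sum := by
  induction s using Multiset.induction_on with
  | empty => simp [Multiset.esymm, Multiset.powersetCard_zero_right]
  | cons a s ih =>
    have h : (a ::ₘ s).esymm 2 = s.esymm 2 + a * s.sum := by
      have hs : (s.map fun x => a * x).sum = a * s.sum := by
        rw [Multiset.sum_map_mul_left, Multiset.map_id']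
      simp [Multiset.esymm, Multiset.powersetCard_cons, Multiset.powersetCard_one, hs]
    rw [h, mul_add, ih, Multiset.map_cons, Multiset.sum_cons, Multiset.sum_cons]
    ring

/-- Expansions in base `D` with digits less than `D` are unique. -/
theorem eq_of_sum_mul_pow_eq {D n : ℕ} {c d : Fin n → ℕ} (hc : ∀ i, c i < D) (hd : ∀ i, d i < D)
    (h : ∑ i, c i * D ^ (i : ℕ) = ∑ i, d i * D ^ (i : ℕ)) : c = d := by
  induction n with
  | zero => exact Subsingleton.elim _ _
  | succ n ih =>
    have expand (f : Fin (n + 1) → ℕ) :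
        ∑ i, f i * D ^ (i : ℕ) = f 0 + D * ∑ i : Fin n, f i.succ * D ^ (i : ℕ) := by
      rw [Fin.sum_univ_succ, Finset.mul_sum]
      simp only [Fin.val_zero, pow_zero, mul_one, Fin.val_succ, pow_succ]
      congr 1
      exact Finset.sum_congr rfl fun i _ => by ring
    rw [expand, expand] at h
    have h0 : c 0 = d 0 := by
      have := congrArg (· % D) h
      simpa [Nat.add_mul_mod_self_left, Nat.mod_eq_of_lt (hc 0), Nat.mod_eq_of_lt (hd 0)] using this
    have hD : 0 < D := (Nat.zero_le _).trans_lt (hc 0)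
    rw [h0] at h
    have hs := ih (fun i => hc i.succ) (fun i => hd i.succ)
      (Nat.eq_of_mul_eq_mul_left hD (Nat.add_left_cancel h))
    funext i
    exact Fin.cases h0 (fun j => congrFun hs j) i

open scoped Classical in
/-- The semistandard Young tableaux of shape `lam` with entries in `{0, …, n-1}`. -/
noncomputable def ssyts (lam : List ℕ) (n : ℕ) :
    Finset ((i : Fin lam.length) → Fin (lam.get i) → Fin n) :=
  Finset.univ.filter fun T =>
    (∀ (i : Fin lam.length) (j j' : Fin (lam.get i)), (j : ℕ) ≤ (j' : ℕ) → T i j ≤ T i j') ∧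
    (∀ (i i' : Fin lam.length), (i : ℕ) < (i' : ℕ) →
      ∀ (j : Fin (lam.get i')) (hj : (j : ℕ) < lam.get i), T i ⟨j, hj⟩ < T i' j)

/-- The number of cells of the filling `T` with entry `a`. -/
def content {lam : List ℕ} {n : ℕ} (T : (i : Fin lam.length) → Fin (lam.get i) → Fin n)
    (a : Fin n) : ℕ :=
  ∑ i, ∑ j, if T i j = a then 1 else 0

theorem sum_cells_eq_sum_content {R : Type*} [CommSemiring R] {lam : List ℕ} {n : ℕ}
    (T : (i : Fin lam.length) → Fin (lam.get i) → Fin n) (φ : Fin n → R) :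
    ∑ i, ∑ j, φ (T i j) = ∑ a, (content T a : R) * φ a := by
  simp only [content, Nat.cast_sum, Finset.sum_mul]
  rw [Finset.sum_comm]
  refine Finset.sum_congr rfl fun i _ => ?_
  rw [Finset.sum_comm]
  refine Finset.sum_congr rfl fun j _ => ?_
  simp

theorem sum_mul_sum_cells {R : Type*} [CommSemiring R] {lam : List ℕ} {n : ℕ}
    (φ ψ : Fin n → R) :
    ∑ T ∈ ssyts lam n, (∑ i, ∑ j, φ (T i j)) * (∑ i, ∑ j, ψ (T i j)) =
      ∑ a, ∑ b, ((∑ T ∈ ssyts lam n, content T a * content T b : ℕ) : R) * (φ a * ψ b) := by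
  simp only [sum_cells_eq_sum_content, Finset.sum_mul_sum]
  rw [Finset.sum_comm]
  refine Finset.sum_congr rfl fun a _ => ?_
  rw [Finset.sum_comm]
  refine Finset.sum_congr rfl fun b _ => ?_
  rw [Nat.cast_sum, Finset.sum_mul]
  refine Finset.sum_congr rfl fun T _ => ?_
  push_cast
  ring

theorem two_mul_esymm_two_ssytWeights (lam : List ℕ) (n c A B : ℕ)
    (hsum : ∀ a, ∑ T ∈ ssyts lam n, content T a = c)
    (hpair : ∀ a b, ∑ T ∈ ssyts lam n, content T a * content T b = if a = b then A else B) :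
    2 * Multiset.esymm (ssytWeights lam n) 2 =
      ((c : MvPolynomial (Fin n) ℤ) ^ 2 - A) * esymm (Fin n) ℤ 1 ^ 2
        + 2 * ((A : MvPolynomial (Fin n) ℤ) - B) * esymm (Fin n) ℤ 2 := by
  have hW : ssytWeights lam n =
      (ssyts lam n).val.map fun T => ∑ i, ∑ j, (X (T i j) : MvPolynomial (Fin n) ℤ) := rfl
  have h1 : ∑ T ∈ ssyts lam n, ∑ i, ∑ j, (X (T i j) : MvPolynomial (Fin n) ℤ)
      = c * esymm (Fin n) ℤ 1 := by
    simp only [sum_cells_eq_sum_content]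
    rw [Finset.sum_comm, esymm_one, Finset.mul_sum]
    refine Finset.sum_congr rfl fun a _ => ?_
    rw [← Finset.sum_mul, ← hsum a, Nat.cast_sum]
  have h2 : ∑ T ∈ ssyts lam n, (∑ i, ∑ j, (X (T i j) : MvPolynomial (Fin n) ℤ)) ^ 2
      = B * esymm (Fin n) ℤ 1 ^ 2
        + ((A : MvPolynomial (Fin n) ℤ) - B) * ∑ a : Fin n, (X a : MvPolynomial (Fin n) ℤ) ^ 2 := by
    simp only [sq]
    rw [sum_mul_sum_cells, esymm_one, Finset.sum_mul_sum, Finset.mul_sum, Finset.mul_sum,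
      ← Finset.sum_add_distrib]
    refine Finset.sum_congr rfl fun a _ => ?_
    have split (b : Fin n) :
        ((if a = b then A else B : ℕ) : MvPolynomial (Fin n) ℤ) * (X a * X b) =
          (B : MvPolynomial (Fin n) ℤ) * (X a * X b) +
            if a = b then ((A : MvPolynomial (Fin n) ℤ) - (B : MvPolynomial (Fin n) ℤ)) *
              (X a * X b) else 0 := by
      split_ifs <;> ring
    simp only [hpair, split, Finset.sum_add_distrib, Finset.mul_sum]
    simp
  have h3 := Multiset.two_mul_esymm_two
    ((Finset.univ : Finset (Fin n)).val.map (X : Fin n → MvPolynomial (Fin n) ℤ))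
  rw [← esymm_eq_multiset_esymm, Multiset.map_map] at h3
  have h4 : esymm (Fin n) ℤ 1
      = ((Finset.univ : Finset (Fin n)).val.map (X : Fin n → MvPolynomial (Fin n) ℤ)).sum :=
    esymm_one _ _
  have h5 : (Multiset.map ((fun x : MvPolynomial (Fin n) ℤ => x ^ 2) ∘ X)
      (Finset.univ : Finset (Fin n)).val).sum
        = ∑ a : Fin n, (X a : MvPolynomial (Fin n) ℤ) ^ 2 := rfl
  rw [← h4, h5] at h3
  rw [Multiset.two_mul_esymm_two, hW, Multiset.map_map]
  change (∑ T ∈ ssyts lam n, ∑ i, ∑ j, (X (T i j) : MvPolynomial (Fin n) ℤ)) ^ 2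
    - ∑ T ∈ ssyts lam n, (∑ i, ∑ j, (X (T i j) : MvPolynomial (Fin n) ℤ)) ^ 2 = _
  rw [h1, h2]
  linear_combination ((B : MvPolynomial (Fin n) ℤ) - A) * h3

/-- The sum `f 0 + … + f (n - 1)`, by structural recursion so that it evaluates in the kernel. -/
def natSum : ℕ → (ℕ → ℕ) → ℕ
  | 0, _ => 0
  | n + 1, f => natSum n f + f n

theorem sum_univ_eq_natSum (n : ℕ) (f : ℕ → ℕ) : ∑ i : Fin n, f i = natSum n f := by
  rw [Fin.sum_univ_eq_sum_range]
  induction n with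
  | zero => rfl
  | succ n ih => rw [Finset.sum_range_succ, ih, natSum]

/-- The sum over semistandard tableaux of shape `(3, 3)` with columns `(pᵢ, qᵢ)` and entries less
than `n` of the product of the sums of `D ^ (n * t)` and of `D ^ t` over the entries `t`. -/
def packedPairSum (n D : ℕ) : ℕ :=
  natSum n fun p₁ => natSum n fun q₁ => bif Nat.blt p₁ q₁ then
  natSum n fun p₂ => bif Nat.ble p₁ p₂ then
  natSum n fun q₂ => bif Nat.blt p₂ q₂ && Nat.ble q₁ q₂ then
  natSum n fun p₃ => bif Nat.ble p₂ p₃ then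
  natSum n fun q₃ => bif Nat.blt p₃ q₃ && Nat.ble q₂ q₃ then
    (D ^ (n * p₁) + D ^ (n * p₂) + D ^ (n * p₃) + (D ^ (n * q₁) + D ^ (n * q₂) + D ^ (n * q₃))) *
    (D ^ p₁ + D ^ p₂ + D ^ p₃ + (D ^ q₁ + D ^ q₂ + D ^ q₃))
  else 0 else 0 else 0 else 0 else 0

/-- The `n × n` matrix with entries `A` on the diagonal and `B` off it, packed in base `D`. -/
def packedMatrix (n A B D : ℕ) : ℕ :=
  natSum n fun a => natSum n fun b => (bif Nat.beq a b then A else B) * (D ^ (n * a) * D ^ b)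

/-- Fillings of the shape `(3, 3)` as sextuples of entries, listed column by column. -/
def fillingEquiv (n : ℕ) :
    Fin n × Fin n × Fin n × Fin n × Fin n × Fin n ≃
      ((i : Fin [3, 3].length) → Fin ([3, 3].get i) → Fin n) where
  toFun t := fun
    | 0 => ![t.1, t.2.2.1, t.2.2.2.2.1]
    | 1 => ![t.2.1, t.2.2.2.1, t.2.2.2.2.2]
  invFun T := (T 0 (0 : Fin 3), T 1 (0 : Fin 3), T 0 (1 : Fin 3), T 1 (1 : Fin 3),
    T 0 (2 : Fin 3), T 1 (2 : Fin 3))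
  left_inv _ := rfl
  right_inv T := by
    funext i j
    match i with
    | 0 =>
      change Fin 3 at j
      fin_cases j <;> rfl
    | 1 =>
      change Fin 3 at j
      fin_cases j <;> rfl

theorem fillingEquiv_mem_ssyts {n : ℕ} (p₁ q₁ p₂ q₂ p₃ q₃ : Fin n) :
    fillingEquiv n (p₁, q₁, p₂, q₂, p₃, q₃) ∈ ssyts [3, 3] n ↔
      p₁ < q₁ ∧ p₁ ≤ p₂ ∧ (p₂ < q₂ ∧ q₁ ≤ q₂) ∧ p₂ ≤ p₃ ∧ p₃ < q₃ ∧ q₂ ≤ q₃ := by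
  simp only [ssyts, Finset.mem_filter, Finset.mem_univ, true_and]
  constructor
  · rintro ⟨hr, hc⟩
    have hcol (j : Fin 3) : fillingEquiv n (p₁, q₁, p₂, q₂, p₃, q₃) 0 j <
        fillingEquiv n (p₁, q₁, p₂, q₂, p₃, q₃) 1 j := hc 0 1 (by decide) j j.isLt
    exact ⟨hcol 0, hr 0 (0 : Fin 3) (1 : Fin 3) (by decide),
      ⟨hcol 1, hr 1 (0 : Fin 3) (1 : Fin 3) (by decide)⟩,
      hr 0 (1 : Fin 3) (2 : Fin 3) (by decide), hcol 2, hr 1 (1 : Fin 3) (2 : Fin 3) (by decide)⟩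
  · rintro ⟨h1, h2, ⟨h3, h4⟩, h5, h6, h7⟩
    constructor
    · intro i j j' hj
      match i with
      | 0 =>
        change Fin 3 at j j'
        fin_cases j <;> fin_cases j' <;>
          first
          | exact absurd hj (by decide)
          | exact le_refl _
          | exact h2
          | exact h5
          | exact h2.trans h5
      | 1 =>
        change Fin 3 at j j'
        fin_cases j <;> fin_cases j' <;>
          first
          | exact absurd hj (by decide)
          | exact le_refl _
          | exact h4
          | exact h7
          | exact h4.trans h7
    · intro i i' hi j hj
      match i, i' with
      | 0, 0 => exact absurd hi (by decide)
      | 1, 0 => exact absurd hi (by decide)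
      | 1, 1 => exact absurd hi (by decide)
      | 0, 1 =>
        change Fin 3 at j
        fin_cases j
        exacts [h1, h3, h6]

theorem sum_cells_fillingEquiv {R : Type*} [AddCommMonoid R] {n : ℕ} (φ : Fin n → R)
    (p₁ q₁ p₂ q₂ p₃ q₃ : Fin n) :
    ∑ i, ∑ j, φ (fillingEquiv n (p₁, q₁, p₂, q₂, p₃, q₃) i j) =
      φ p₁ + φ p₂ + φ p₃ + (φ q₁ + φ q₂ + φ q₃) := by
  refine (Fin.sum_univ_two (fun i : Fin 2 =>
    ∑ j, φ (fillingEquiv n (p₁, q₁, p₂, q₂, p₃, q₃) i j))).trans ?_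
  exact congrArg₂ (· + ·) (Fin.sum_univ_three _) (Fin.sum_univ_three _)

theorem sum_ssyts_eq_packedPairSum (n D : ℕ) :
    ∑ T ∈ ssyts [3, 3] n,
      (∑ i, ∑ j, D ^ (n * (T i j : ℕ))) * (∑ i, ∑ j, D ^ (T i j : ℕ)) = packedPairSum n D := by
  classical
  rw [← Finset.univ_inter (ssyts [3, 3] n), ← Finset.sum_ite_mem, ← (fillingEquiv n).sum_comp]
  simp only [Fintype.sum_prod_type, fillingEquiv_mem_ssyts,
    sum_cells_fillingEquiv (fun t : Fin n => D ^ (n * (t : ℕ))),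
    sum_cells_fillingEquiv (fun t : Fin n => D ^ (t : ℕ))]
  simp only [packedPairSum, ← sum_univ_eq_natSum]
  refine Finset.sum_congr rfl fun p₁ _ => Finset.sum_congr rfl fun q₁ _ => ?_
  have hlt (a b : Fin n) : Nat.blt a b = decide (a < b) := by
    rw [Bool.eq_iff_iff]; simp [Nat.blt_eq]
  have hle (a b : Fin n) : Nat.ble a b = decide (a ≤ b) := by
    rw [Bool.eq_iff_iff]; simp
  simp only [hlt, hle, ← Bool.decide_and, Bool.cond_decide, ite_and, Finset.sum_ite_irrel,
    Finset.sum_const_zero]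

theorem content_le {n : ℕ} (T : (i : Fin [3, 3].length) → Fin ([3, 3].get i) → Fin n) (a : Fin n) :
    content T a ≤ 6 := by
  calc content T a ≤ ∑ i : Fin [3, 3].length, ∑ _j : Fin ([3, 3].get i), 1 :=
        Finset.sum_le_sum fun i _ => Finset.sum_le_sum fun j _ => by split_ifs <;> simp
    _ = 6 := by decide

theorem card_ssyts_le (n : ℕ) : (ssyts [3, 3] n).card ≤ n * (n * (n * (n * (n * n)))) := by
  refine (Finset.card_le_univ _).trans ?_
  rw [← Fintype.card_congr (fillingEquiv n)]
  simp only [Fintype.card_prod, Fintype.card_fin, le_refl]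

theorem sum_content_mul_content_le {n : ℕ} (a b : Fin n) :
    ∑ T ∈ ssyts [3, 3] n, content T a * content T b ≤ n * (n * (n * (n * (n * n)))) * 36 := by
  calc ∑ T ∈ ssyts [3, 3] n, content T a * content T b ≤ (ssyts [3, 3] n).card * 36 := by
        rw [← smul_eq_mul]
        exact Finset.sum_le_card_nsmul _ _ _ fun T _ =>
          Nat.mul_le_mul (content_le T a) (content_le T b)
    _ ≤ n * (n * (n * (n * (n * n)))) * 36 := Nat.mul_le_mul_right _ (card_ssyts_le n)

theorem sum_mul_pow_mul_pow_eq {n : ℕ} (D : ℕ) (f : Fin n → Fin n → ℕ) :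
    ∑ a : Fin n, ∑ b : Fin n, f a b * (D ^ (n * (a : ℕ)) * D ^ (b : ℕ)) =
      ∑ k : Fin (n * n), f k.divNat k.modNat * D ^ (k : ℕ) := by
  rw [← Fintype.sum_prod_type', ← finProdFinEquiv.symm.sum_comp]
  refine Finset.sum_congr rfl fun k _ => ?_
  rw [← pow_add, finProdFinEquiv_symm_apply]
  simp only [Fin.coe_divNat, Fin.coe_modNat, Nat.div_add_mod]

theorem sum_content_mul_content_of_packed {n A B D : ℕ} (hA : A < D) (hB : B < D)
    (hD : n * (n * (n * (n * (n * n)))) * 36 < D)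
    (hpack : packedPairSum n D = packedMatrix n A B D) (a b : Fin n) :
    ∑ T ∈ ssyts [3, 3] n, content T a * content T b = if a = b then A else B := by
  rw [← sum_ssyts_eq_packedPairSum, sum_mul_sum_cells (fun t : Fin n => D ^ (n * (t : ℕ)))
    (fun t : Fin n => D ^ (t : ℕ)), packedMatrix] at hpack
  simp only [← sum_univ_eq_natSum, Nat.cast_id] at hpack
  have hbeq (a b : Fin n) : Nat.beq a b = decide (a = b) := by
    rw [Bool.eq_iff_iff]
    simp [Fin.ext_iff]
  simp only [hbeq, Bool.cond_decide] at hpack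
  rw [sum_mul_pow_mul_pow_eq D (fun a b => ∑ T ∈ ssyts [3, 3] n, content T a * content T b),
    sum_mul_pow_mul_pow_eq D (fun a b => if a = b then A else B)] at hpack
  have h := congrFun (eq_of_sum_mul_pow_eq
    (fun _ => (sum_content_mul_content_le _ _).trans_lt hD)
    (fun _ => by split_ifs <;> assumption) hpack) (finProdFinEquiv (a, b))
  have hab := finProdFinEquiv.symm_apply_apply (a, b)
  rw [finProdFinEquiv_symm_apply, Prod.mk.injEq] at hab
  simpa only [hab.1, hab.2] using h

theorem six_mul_sum_content {n A B : ℕ}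
    (hpair : ∀ a b : Fin n, ∑ T ∈ ssyts [3, 3] n, content T a * content T b = if a = b then A else B)
    (a : Fin n) : (∑ T ∈ ssyts [3, 3] n, content T a) * 6 + B = A + n * B := by
  have htotal (T : (i : Fin [3, 3].length) → Fin ([3, 3].get i) → Fin n) :
      ∑ b, content T b = 6 := by
    have h := sum_cells_eq_sum_content T (fun _ => 1)
    simp only [Nat.cast_id, mul_one] at h
    rw [← h]
    decide
  have h : ∑ b, ∑ T ∈ ssyts [3, 3] n, content T a * content T b =
      (∑ T ∈ ssyts [3, 3] n, content T a) * 6 := by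
    rw [Finset.sum_comm, Finset.sum_mul]
    exact Finset.sum_congr rfl fun T _ => by rw [← Finset.mul_sum, htotal]
  have hrow : ∑ b : Fin n, ((if a = b then A else B) + if a = b then B else 0) =
      ∑ b : Fin n, ((if a = b then A else 0) + B) :=
    Finset.sum_congr rfl fun b _ => by split_ifs <;> simp
  simp only [Finset.sum_add_distrib, Finset.sum_ite_eq, Finset.mem_univ, if_true,
    Finset.sum_const, Finset.card_univ, Fintype.card_fin, smul_eq_mul] at hrow
  simp only [hpair] at h
  rw [← h, hrow]

theorem packedPairSum_nine :
    packedPairSum 9 33554432 = packedMatrix 9 5280 1815 33554432 := by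
  decide +kernel

/-- `c₂(γ9^[3, 3]) = 3465·c₂(γ9)`: the second elementary symmetric function of
the multiset of weights of semistandard Young tableaux of shape `[3, 3]` with
entries in `{0, …, 8}` is congruent to `3465·e₂` modulo the ideal generated
by `e₁`. -/
theorem c2_ssyt_stmt14 :
    Multiset.esymm (ssytWeights [3, 3] 9) 2 - 3465 * esymm (Fin 9) ℤ 2
      ∈ Ideal.span {esymm (Fin 9) ℤ 1} := by
  have hpair := sum_content_mul_content_of_packed (by norm_num) (by norm_num) (by norm_num)
    packedPairSum_nine
  have hsum (a : Fin 9) : ∑ T ∈ ssyts [3, 3] 9, content T a = 3300 := by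
    have := six_mul_sum_content hpair a
    omega
  have h := two_mul_esymm_two_ssytWeights [3, 3] 9 3300 5280 1815 hsum hpair
  have key : Multiset.esymm (ssytWeights [3, 3] 9) 2 - 3465 * esymm (Fin 9) ℤ 2
      = 5442360 * esymm (Fin 9) ℤ 1 * esymm (Fin 9) ℤ 1 := by
    refine mul_left_cancel₀ (two_ne_zero : (2 : MvPolynomial (Fin 9) ℤ) ≠ 0) ?_
    push_cast at h
    linear_combination h
  rw [key]
  exact Ideal.mul_mem_left _ _ (Ideal.subset_span rfl)
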